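/- Let ω be a nondegenerate alternating bilinear form on ℝ^4 taking integer values on ℤ^4 × ℤ^4, and let η ≠ η' be real numbers. Let U_ω = {V ∈ Gr(ℝ^4, 2) : ω restricted to V is nondegenerate}, and let U_ω(ℤ, η, η') be the set of V ∈ U_ω for which there exists a 4×4 integer matrix A with A w = η w for all w ∈ V and A w = η' w for all w in the ω-orthogonal complement of V. Then U_ω(ℤ, η, η') is closed and discrete in U_ω: every point of U_ω has an open neighborhood in U_ω meeting U_ω(ℤ, η, η') in at most one point. -/

import Mathlib

open MeasureTheory Matrix

/-- Pairs of linearly independent vectors in `ℝ^n`. -/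
abbrev GrPair (n : ℕ) := {p : (Fin n → ℝ) × (Fin n → ℝ) // LinearIndependent ℝ ![p.1, p.2]}

/-- Two pairs are identified iff they span the same plane. -/
def grSetoid (n : ℕ) : Setoid (GrPair n) where
  r p q := Submodule.span ℝ {p.1.1, p.1.2} = Submodule.span ℝ {q.1.1, q.1.2}
  iseqv := ⟨fun _ => rfl, Eq.symm, Eq.trans⟩

/-- The Grassmannian `Gr(ℝ^n, 2)` of `2`-dimensional subspaces of `ℝ^n`, realized as the quotient
of the set of linearly independent pairs by the relation of having equal span, with the quotient
topology. -/
def Gr2 (n : ℕ) : Type := Quotient (grSetoid n)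

instance (n : ℕ) : TopologicalSpace (Gr2 n) := instTopologicalSpaceQuotient

instance (n : ℕ) : MeasurableSpace (Gr2 n) := borel (Gr2 n)

/-- The plane represented by a point of the Grassmannian. -/
def Gr2.toSubmodule {n : ℕ} : Gr2 n → Submodule ℝ (Fin n → ℝ) :=
  Quotient.lift (fun p : GrPair n => Submodule.span ℝ {p.1.1, p.1.2}) (fun _ _ h => h)


/-- A vector in `ℝ^d` has integer coordinates, i.e. lies in `ℤ^d`. -/
def IsIntVec {d : ℕ} (v : Fin d → ℝ) : Prop := ∀ i, ∃ n : ℤ, v i = n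

/-- `ω` restricted to the plane `W` is nondegenerate. -/
def NondegOn {d : ℕ} (ω : (Fin d → ℝ) →ₗ[ℝ] (Fin d → ℝ) →ₗ[ℝ] ℝ)
    (W : Submodule ℝ (Fin d → ℝ)) : Prop :=
  ∀ v ∈ W, (∀ w ∈ W, ω v w = 0) → v = 0

/-- Membership in `U_ω(ℤ, η, η')`: there is an integer matrix `A` acting as `η` on the plane of
`V` and as `η'` on its `ω`-orthogonal complement. -/
def IsEtaIntegralPlane (ω : (Fin 4 → ℝ) →ₗ[ℝ] (Fin 4 → ℝ) →ₗ[ℝ] ℝ) (η η' : ℝ)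
    (V : Gr2 4) : Prop :=
  ∃ A : Matrix (Fin 4) (Fin 4) ℤ,
    (∀ w ∈ V.toSubmodule, (A.map (Int.cast : ℤ → ℝ)).mulVec w = η • w) ∧
    (∀ w : Fin 4 → ℝ, (∀ v ∈ V.toSubmodule, ω w v = 0) →
      (A.map (Int.cast : ℤ → ℝ)).mulVec w = η' • w)

section OrthogonalProjection

variable {d : ℕ} (ω : (Fin d → ℝ) →ₗ[ℝ] (Fin d → ℝ) →ₗ[ℝ] ℝ)

/-- The `ω`-orthogonal projection of `x` to the plane spanned by `v` and `w`, when `ω v w ≠ 0`. -/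
noncomputable def planeProj (v w x : Fin d → ℝ) : Fin d → ℝ :=
  (ω v w)⁻¹ • (ω x w • v - ω x v • w)

theorem planeProj_mem (v w x : Fin d → ℝ) :
    planeProj ω v w x ∈ Submodule.span ℝ {v, w} :=
  Submodule.smul_mem _ _ <| Submodule.sub_mem _
    (Submodule.smul_mem _ _ (Submodule.subset_span (by simp)))
    (Submodule.smul_mem _ _ (Submodule.subset_span (by simp)))

theorem continuous_bilinear_apply :
    Continuous fun p : (Fin d → ℝ) × (Fin d → ℝ) => ω p.1 p.2 :=
  ω.toContinuousBilinearMap.continuous₂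

theorem continuousOn_planeProj (x : Fin d → ℝ) :
    ContinuousOn (fun p : (Fin d → ℝ) × (Fin d → ℝ) => planeProj ω p.1 p.2 x)
      {p | ω p.1 p.2 ≠ 0} := by
  have hx : Continuous (ω x) := (ω x).continuous_of_finiteDimensional
  unfold planeProj
  exact ((continuous_bilinear_apply ω).continuousOn.inv₀ fun _ hp => hp).smul
    (by fun_prop : Continuous fun p : (Fin d → ℝ) × (Fin d → ℝ) =>
      ω x p.2 • p.1 - ω x p.1 • p.2).continuousOn

variable {ω}

theorem apply_sub_planeProj (hω : ∀ v, ω v v = 0) {v w : Fin d → ℝ} (hvw : ω v w ≠ 0)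
    (x : Fin d → ℝ) {y : Fin d → ℝ} (hy : y ∈ Submodule.span ℝ {v, w}) :
    ω (x - planeProj ω v w x) y = 0 := by
  have hwv : ω w v = -ω v w := (LinearMap.IsAlt.neg (B := ω) hω v w).symm
  obtain ⟨a, b, rfl⟩ := Submodule.mem_span_pair.1 hy
  simp only [planeProj, map_sub, map_smul, map_add, LinearMap.sub_apply, LinearMap.smul_apply,
    smul_eq_mul, hω, hwv]
  field_simp
  ring

theorem nondegOn_span_pair_iff (hω : ∀ v, ω v v = 0) {v w : Fin d → ℝ} (hv : v ≠ 0) :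
    NondegOn ω (Submodule.span ℝ {v, w}) ↔ ω v w ≠ 0 := by
  constructor
  · intro h hvw
    refine hv (h v (Submodule.subset_span (by simp)) fun y hy => ?_)
    obtain ⟨a, b, rfl⟩ := Submodule.mem_span_pair.1 hy
    simp [hω, hvw]
  · intro hvw x hx hxy
    have hwv : ω w v = -ω v w := (LinearMap.IsAlt.neg (B := ω) hω v w).symm
    have h1 := hxy v (Submodule.subset_span (by simp))
    have h2 := hxy w (Submodule.subset_span (by simp))
    obtain ⟨a, b, rfl⟩ := Submodule.mem_span_pair.1 hx
    simp_all

theorem eq_planeProj (hω : ∀ v, ω v v = 0) {v w x u : Fin d → ℝ} (hvw : ω v w ≠ 0)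
    (hu : u ∈ Submodule.span ℝ {v, w})
    (hxu : ∀ y ∈ Submodule.span ℝ {v, w}, ω (x - u) y = 0) :
    u = planeProj ω v w x := by
  have hv : v ≠ 0 := by rintro rfl; simp at hvw
  refine sub_eq_zero.1 ((nondegOn_span_pair_iff hω hv).2 hvw _
    (Submodule.sub_mem _ hu (planeProj_mem ω v w x)) fun y hy => ?_)
  have h := apply_sub_planeProj hω hvw x hy
  have h' := hxu y hy
  simp only [map_sub, LinearMap.sub_apply] at h h' ⊢
  linarith

end OrthogonalProjection

theorem Gr2.toSubmodule_injective {n : ℕ} : Function.Injective (Gr2.toSubmodule (n := n)) := by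
  rintro ⟨p⟩ ⟨q⟩ h
  exact Quotient.sound h

section EigenNeighborhood

variable (ω : (Fin 4 → ℝ) →ₗ[ℝ] (Fin 4 → ℝ) →ₗ[ℝ] ℝ) (η η' : ℝ)

/-- The planes `W` on which `ω` is nondegenerate and such that the endomorphism acting as `η` on
`W` and as `η'` on its `ω`-orthogonal complement has all matrix entries within `1 / 2` of `M`. -/
def eigenNhd (M : Matrix (Fin 4) (Fin 4) ℝ) : Set (Gr2 4) :=
  {W | NondegOn ω W.toSubmodule ∧ ∀ i j, ∀ u ∈ W.toSubmodule,
    (∀ y ∈ W.toSubmodule, ω (Pi.single j 1 - u) y = 0) →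
      |(η' • (Pi.single j 1 : Fin 4 → ℝ) + (η - η') • u) i - M i j| < 1 / 2}

variable {ω}

theorem mk_mem_eigenNhd_iff (hω : ∀ v, ω v v = 0) (M : Matrix (Fin 4) (Fin 4) ℝ) (p : GrPair 4) :
    (Quotient.mk (grSetoid 4) p : Gr2 4) ∈ eigenNhd ω η η' M ↔
      ω p.1.1 p.1.2 ≠ 0 ∧ ∀ i j, |(η' • (Pi.single j 1 : Fin 4 → ℝ) +
        (η - η') • planeProj ω p.1.1 p.1.2 (Pi.single j 1)) i - M i j| < 1 / 2 := by
  have hp : p.1.1 ≠ 0 := p.2.ne_zero 0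
  refine (and_congr_left' (nondegOn_span_pair_iff hω hp)).trans (and_congr_right fun hvw => ?_)
  refine forall₂_congr fun i j => ⟨fun h => ?_, fun h u hu hxu => ?_⟩
  · exact h _ (planeProj_mem ω _ _ _) fun y hy => apply_sub_planeProj hω hvw _ hy
  · rwa [eq_planeProj hω hvw hu hxu]

theorem isOpen_eigenNhd (hω : ∀ v, ω v v = 0) (M : Matrix (Fin 4) (Fin 4) ℝ) :
    IsOpen (eigenNhd ω η η' M) := by
  refine (isQuotientMap_quotient_mk' (s := grSetoid 4)).isOpen_preimage.1 ?_
  have hU : IsOpen {p : (Fin 4 → ℝ) × (Fin 4 → ℝ) | ω p.1 p.2 ≠ 0} :=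
    isOpen_ne_fun (continuous_bilinear_apply ω) continuous_const
  have hO : IsOpen ({p : (Fin 4 → ℝ) × (Fin 4 → ℝ) | ω p.1 p.2 ≠ 0} ∩
      {p | ∀ i j, |(η' • (Pi.single j 1 : Fin 4 → ℝ) +
        (η - η') • planeProj ω p.1 p.2 (Pi.single j 1)) i - M i j| < 1 / 2}) := by
    simp only [Set.ofPred_forall, Set.inter_iInter]
    refine isOpen_iInter_of_finite fun i => isOpen_iInter_of_finite fun j => ?_
    have h : ContinuousOn (fun p : (Fin 4 → ℝ) × (Fin 4 → ℝ) =>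
        |(η' • (Pi.single j 1 : Fin 4 → ℝ) +
          (η - η') • planeProj ω p.1 p.2 (Pi.single j 1)) i - M i j|) {p | ω p.1 p.2 ≠ 0} :=
      (((continuous_apply i).comp_continuousOn (continuousOn_const.add
        ((continuousOn_planeProj ω (Pi.single j 1)).const_smul (η - η')))).sub
          continuousOn_const).abs
    exact h.isOpen_inter_preimage hU isOpen_Iio
  convert hO.preimage continuous_subtype_val using 1
  ext p
  exact mk_mem_eigenNhd_iff η η' hω M p

variable {η η'}

theorem exists_mem_eigenNhd (hω : ∀ v, ω v v = 0) {V : Gr2 4} (hV : NondegOn ω V.toSubmodule) :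
    ∃ M, V ∈ eigenNhd ω η η' M := by
  obtain ⟨p⟩ := V
  refine ⟨.of fun i j => (η' • (Pi.single j 1 : Fin 4 → ℝ) +
    (η - η') • planeProj ω p.1.1 p.1.2 (Pi.single j 1)) i, ?_⟩
  refine (mk_mem_eigenNhd_iff η η' hω _ p).2
    ⟨(nondegOn_span_pair_iff hω (p.2.ne_zero 0)).1 hV, fun i j => ?_⟩
  simp

theorem exists_mem_orthogonal_sub (hω : ∀ v, ω v v = 0) {W : Gr2 4}
    (hW : NondegOn ω W.toSubmodule) (x : Fin 4 → ℝ) :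
    ∃ u ∈ W.toSubmodule, ∀ y ∈ W.toSubmodule, ω (x - u) y = 0 := by
  obtain ⟨p⟩ := W
  have hvw := (nondegOn_span_pair_iff hω (p.2.ne_zero 0)).1 hW
  exact ⟨_, planeProj_mem ω p.1.1 p.1.2 x, fun y hy => apply_sub_planeProj hω hvw x hy⟩

theorem mulVec_eq_of_eigen {W : Gr2 4} {A : Matrix (Fin 4) (Fin 4) ℝ}
    (hA : ∀ w ∈ W.toSubmodule, A *ᵥ w = η • w)
    (hA' : ∀ w, (∀ v ∈ W.toSubmodule, ω w v = 0) → A *ᵥ w = η' • w) {x u : Fin 4 → ℝ}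
    (hu : u ∈ W.toSubmodule) (hxu : ∀ y ∈ W.toSubmodule, ω (x - u) y = 0) :
    A *ᵥ x = η' • x + (η - η') • u := by
  have h : A *ᵥ x = A *ᵥ u + A *ᵥ (x - u) := by rw [← Matrix.mulVec_add, add_sub_cancel]
  rw [h, hA u hu, hA' _ hxu]
  module

theorem abs_sub_lt_of_mem_eigenNhd (hω : ∀ v, ω v v = 0) {M : Matrix (Fin 4) (Fin 4) ℝ}
    {W : Gr2 4} (hW : W ∈ eigenNhd ω η η' M) {A : Matrix (Fin 4) (Fin 4) ℝ}
    (hA : ∀ w ∈ W.toSubmodule, A *ᵥ w = η • w)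
    (hA' : ∀ w, (∀ v ∈ W.toSubmodule, ω w v = 0) → A *ᵥ w = η' • w) (i j : Fin 4) :
    |A i j - M i j| < 1 / 2 := by
  obtain ⟨u, hu, hxu⟩ := exists_mem_orthogonal_sub hω hW.1 (Pi.single j 1)
  have h := hW.2 i j u hu hxu
  rwa [← mulVec_eq_of_eigen hA hA' hu hxu, Matrix.mulVec_single_one] at h

theorem toSubmodule_eq_of_eigen (hω : ∀ v, ω v v = 0) (hη : η ≠ η') {W : Gr2 4}
    (hW : NondegOn ω W.toSubmodule) {A : Matrix (Fin 4) (Fin 4) ℝ}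
    (hA : ∀ w ∈ W.toSubmodule, A *ᵥ w = η • w)
    (hA' : ∀ w, (∀ v ∈ W.toSubmodule, ω w v = 0) → A *ᵥ w = η' • w) :
    W.toSubmodule = Module.End.eigenspace A.mulVecLin η := by
  ext x
  rw [Module.End.mem_eigenspace_iff, Matrix.mulVecLin_apply]
  refine ⟨hA x, fun hx => ?_⟩
  obtain ⟨u, hu, hxu⟩ := exists_mem_orthogonal_sub hω hW x
  rw [mulVec_eq_of_eigen hA hA' hu hxu] at hx
  have h : (η - η') • (x - u) = 0 := by
    rw [smul_sub, sub_smul, ← hx]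
    module
  rwa [sub_eq_zero.1 ((smul_eq_zero.1 h).resolve_left (sub_ne_zero.2 hη))]

end EigenNeighborhood

/-- for a nondegenerate alternating bilinear form `ω` on `ℝ^4` that is integral on
`ℤ^4`, and reals `η ≠ η'`, the set `U_ω(ℤ, η, η')` is closed and discrete in
`U_ω = {V ∈ Gr(ℝ^4, 2) : ω|_V nondegenerate}`: every point of `U_ω` has an open neighborhood
meeting `U_ω(ℤ, η, η') ⊆ U_ω` in at most one point. -/
theorem eigen_integral_planes_discrete
    (ω : (Fin 4 → ℝ) →ₗ[ℝ] (Fin 4 → ℝ) →ₗ[ℝ] ℝ)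
    (hωalt : ∀ v, ω v v = 0)
    (hωnondeg : ∀ v : Fin 4 → ℝ, (∀ w : Fin 4 → ℝ, ω v w = 0) → v = 0)
    (hωint : ∀ v w : Fin 4 → ℝ, IsIntVec v → IsIntVec w → ∃ n : ℤ, ω v w = n)
    (η η' : ℝ) (hη : η ≠ η') :
    ∀ V : Gr2 4, NondegOn ω V.toSubmodule →
      ∃ O : Set (Gr2 4), IsOpen O ∧ V ∈ O ∧
        Set.Subsingleton
          {W ∈ O | NondegOn ω W.toSubmodule ∧ IsEtaIntegralPlane ω η η' W} := by
  intro V hV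
  obtain ⟨M, hM⟩ := exists_mem_eigenNhd (η := η) (η' := η') hωalt hV
  refine ⟨eigenNhd ω η η' M, isOpen_eigenNhd η η' hωalt M, hM, ?_⟩
  rintro W ⟨hWO, hW, A, hA, hA'⟩ W' ⟨hWO', hW', B, hB, hB'⟩
  have hAB : A = B := by
    ext i j
    have h₁ := abs_sub_lt_of_mem_eigenNhd hωalt hWO hA hA' i j
    have h₂ := abs_sub_lt_of_mem_eigenNhd hωalt hWO' hB hB' i j
    rw [Matrix.map_apply] at h₁ h₂
    have h : |((A i j - B i j : ℤ) : ℝ)| < 1 := by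
      rw [abs_lt] at *
      push_cast
      constructor <;> linarith
    exact sub_eq_zero.1 (Int.abs_lt_one_iff.1 (by exact_mod_cast h))
  subst hAB
  apply Gr2.toSubmodule_injective
  rw [toSubmodule_eq_of_eigen hωalt hη hW hA hA', toSubmodule_eq_of_eigen hωalt hη hW' hB hB']
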